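/- Let W : Ω × ℝ^d × ℝ^{d×N} → ℝ be continuous, satisfy the linear growth and coercivity condition (1/C)|ξ| - C ≤ W(x,u,ξ) ≤ C(1+|ξ|), and the uniform local continuity condition in (x,u) with modulus ω_K(|x-x'|+|u-u'|)(1+|ξ|) on compacts K. Then the quasiconvex envelope QW : Ω × ℝ^d × ℝ^{d×N} → ℝ is jointly continuous. -/

import Mathlib

open MeasureTheory Filter Set

noncomputable section

/-- The open unit cube `Q = (0,1)^N` in `ℝ^N`. -/
def unitCube (N : ℕ) : Set (Fin N → ℝ) := Set.univ.pi fun _ => Set.Ioo (0:ℝ) 1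

/-- The gradient matrix `∇φ(y) ∈ ℝ^{d×N}` of `φ : ℝ^N → ℝ^d`. -/
def gradMat {N d : ℕ} (φ : (Fin N → ℝ) → (Fin d → ℝ)) (y : Fin N → ℝ) :
    Fin d → Fin N → ℝ := fun i j => fderiv ℝ φ y (Pi.single j 1) i

/-- Test functions in `W_0^{1,∞}(Q;ℝ^d)`: Lipschitz maps vanishing outside the unit cube. -/
def TestFun {N d : ℕ} (φ : (Fin N → ℝ) → (Fin d → ℝ)) : Prop :=
  (∃ K, LipschitzWith K φ) ∧ ∀ y ∉ unitCube N, φ y = 0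

/-- Quasiconvex envelope (quasiconvexification) of `h` computed over the unit cube. -/
def qcEnv {N d : ℕ} (h : (Fin d → Fin N → ℝ) → ℝ) (ξ : Fin d → Fin N → ℝ) : ℝ :=
  sInf {r | ∃ φ, TestFun φ ∧ r = ∫ y in unitCube N, h (ξ + gradMat φ y)}

/-- Recession function: `h^∞(ξ) = limsup_{t→∞} h(tξ)/t`. -/
def recFn {N d : ℕ} (h : (Fin d → Fin N → ℝ) → ℝ) (ξ : Fin d → Fin N → ℝ) : ℝ :=
  Filter.limsup (fun t : ℝ => h (t • ξ) / t) Filter.atTop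

/-- Quasiconvexity in the sense of Morrey: for some bounded open set `D` of positive
measure, `h(ξ) ≤ (1/|D|) ∫_D h(ξ + ∇φ)` for all Lipschitz `φ` vanishing outside `D`. -/
def MorreyQC {N d : ℕ} (h : (Fin d → Fin N → ℝ) → ℝ) : Prop :=
  ∃ D : Set (Fin N → ℝ), IsOpen D ∧ Bornology.IsBounded D ∧ 0 < volume D ∧
    ∀ (ξ : Fin d → Fin N → ℝ) (φ : (Fin N → ℝ) → Fin d → ℝ),
      (∃ K, LipschitzWith K φ) → (∀ y ∉ D, φ y = 0) →
      h ξ ≤ ((volume D).toReal)⁻¹ * ∫ y in D, h (ξ + gradMat φ y)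

/-- A modulus of continuity. -/
def Modulus (ω : ℝ → ℝ) : Prop := Continuous ω ∧ ω 0 = 0 ∧ ∀ t, 0 ≤ ω t

/-- Convex envelope of `g : ℝ^m → ℝ`: pointwise supremum of convex minorants. -/
def convEnv {m : ℕ} (g : (Fin m → ℝ) → ℝ) (v : Fin m → ℝ) : ℝ :=
  sSup {r | ∃ h : (Fin m → ℝ) → ℝ, ConvexOn ℝ Set.univ h ∧ (∀ w, h w ≤ g w) ∧ r = h v}

/-- Supremum of lower semicontinuous convex minorants (the biconjugate `g**`). -/
def biconj {m : ℕ} (g : (Fin m → ℝ) → ℝ) (v : Fin m → ℝ) : ℝ :=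
  sSup {r | ∃ h : (Fin m → ℝ) → ℝ, ConvexOn ℝ Set.univ h ∧ LowerSemicontinuous h ∧
    (∀ w, h w ≤ g w) ∧ r = h v}

/-- Quasiconvex-convex envelope of `f(ξ,v)` over the unit cube. -/
def qcxcEnv {N d m : ℕ} (f : (Fin d → Fin N → ℝ) → (Fin m → ℝ) → ℝ)
    (ξ : Fin d → Fin N → ℝ) (v : Fin m → ℝ) : ℝ :=
  sInf {r | ∃ (ψ : (Fin N → ℝ) → Fin d → ℝ) (η : (Fin N → ℝ) → Fin m → ℝ),
    TestFun ψ ∧ Measurable η ∧ (∃ M, ∀ y, ‖η y‖ ≤ M) ∧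
    (∫ y in unitCube N, η y) = 0 ∧
    r = ∫ y in unitCube N, f (ξ + gradMat ψ y) (v + η y)}


/-- Continuity and linear growth for a single integrand. -/
structure GrowthC {N d : ℕ} (C : ℝ) (h : (Fin d → Fin N → ℝ) → ℝ) : Prop where
  cont : Continuous h
  pos : 0 < C
  lower : ∀ ξ, (1 / C) * ‖ξ‖ - C ≤ h ξ
  upper : ∀ ξ, h ξ ≤ C * (1 + ‖ξ‖)

lemma volume_unitCube (N : ℕ) : volume (unitCube N) = 1 := by
  simp [unitCube, Real.volume_pi_Ioo]

instance isProb_unitCube (N : ℕ) :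
    IsProbabilityMeasure (volume.restrict (unitCube N)) :=
  ⟨by simp [volume_unitCube]⟩

lemma isOpen_unitCube (N : ℕ) : IsOpen (unitCube N) :=
  isOpen_set_pi finite_univ fun _ _ => isOpen_Ioo

lemma measurable_gradMat {N d : ℕ} (φ : (Fin N → ℝ) → (Fin d → ℝ)) :
    Measurable (gradMat φ) := by
  refine measurable_pi_iff.2 fun i => measurable_pi_iff.2 fun j => ?_
  exact (measurable_pi_apply i).comp (measurable_fderiv_apply_const ℝ φ (Pi.single j 1))

lemma norm_gradMat_le {N d : ℕ} {φ : (Fin N → ℝ) → (Fin d → ℝ)} {K : NNReal}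
    (hφ : LipschitzWith K φ) (y : Fin N → ℝ) : ‖gradMat φ y‖ ≤ K := by
  refine (pi_norm_le_iff_of_nonneg K.2).2 fun i => (pi_norm_le_iff_of_nonneg K.2).2 fun j => ?_
  refine (norm_le_pi_norm (fderiv ℝ φ y (Pi.single j 1)) i).trans ?_
  refine ((fderiv ℝ φ y).le_opNorm _).trans ?_
  have h1 : ‖(Pi.single j 1 : Fin N → ℝ)‖ ≤ 1 := by
    refine (pi_norm_le_iff_of_nonneg zero_le_one).2 fun k => ?_
    by_cases hk : k = j
    · subst hk; simp
    · simp [Pi.single_eq_of_ne hk]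
  calc _ ≤ (K : ℝ) * 1 := mul_le_mul (norm_fderiv_le_of_lipschitz ℝ hφ) h1 (norm_nonneg _) K.2
    _ = K := mul_one _

lemma GrowthC.integrable {N d : ℕ} {C : ℝ} {h : (Fin d → Fin N → ℝ) → ℝ} (H : GrowthC C h)
    {φ : (Fin N → ℝ) → (Fin d → ℝ)} (hφ : TestFun φ) (ξ : Fin d → Fin N → ℝ) :
    Integrable (fun y => h (ξ + gradMat φ y)) (volume.restrict (unitCube N)) := by
  obtain ⟨⟨K, hK⟩, -⟩ := hφ
  have hC := H.pos
  refine Integrable.of_bound (C := C * (1 + (‖ξ‖ + K)) + C)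
    ((H.cont.measurable.comp (measurable_const.add (measurable_gradMat φ))).aestronglyMeasurable)
    (ae_of_all _ fun y => ?_)
  have h1 : ‖ξ + gradMat φ y‖ ≤ ‖ξ‖ + K :=
    (norm_add_le _ _).trans (add_le_add le_rfl (norm_gradMat_le hK y))
  have h2 := H.lower (ξ + gradMat φ y)
  have h3 := H.upper (ξ + gradMat φ y)
  have h4 : 0 ≤ (1 / C) * ‖ξ + gradMat φ y‖ := by positivity
  have h5 := mul_le_mul_of_nonneg_left h1 hC.le
  have h6 : 0 ≤ C * (1 + (‖ξ‖ + K)) := by positivity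
  rw [Real.norm_eq_abs, abs_le]
  constructor <;> linarith

lemma integrable_norm_grad {N d : ℕ}
    {φ : (Fin N → ℝ) → (Fin d → ℝ)} (hφ : TestFun φ) (ξ : Fin d → Fin N → ℝ) :
    Integrable (fun y => ‖ξ + gradMat φ y‖) (volume.restrict (unitCube N)) := by
  refine GrowthC.integrable (C := 1) (h := fun ξ => ‖ξ‖) ⟨continuous_norm, one_pos, ?_, ?_⟩ hφ ξ
  · intro ξ; simp
  · intro ξ; simp

lemma GrowthC.neg_le_integral {N d : ℕ} {C : ℝ} {h : (Fin d → Fin N → ℝ) → ℝ} (H : GrowthC C h)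
    {φ : (Fin N → ℝ) → (Fin d → ℝ)} (hφ : TestFun φ) (ξ : Fin d → Fin N → ℝ) :
    -C ≤ ∫ y in unitCube N, h (ξ + gradMat φ y) := by
  have hC := H.pos
  have := integral_mono (μ := volume.restrict (unitCube N)) (integrable_const (-C))
    (H.integrable hφ ξ) (fun y => by
      have h2 := H.lower (ξ + gradMat φ y)
      have h4 : 0 ≤ (1 / C) * ‖ξ + gradMat φ y‖ := by positivity
      show -C ≤ _
      linarith)
  simpa using this

lemma testFun_zero {N d : ℕ} : TestFun (fun _ : Fin N → ℝ => (0 : Fin d → ℝ)) :=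
  ⟨⟨0, LipschitzWith.const _⟩, fun _ _ => rfl⟩

lemma gradMat_zero {N d : ℕ} (y : Fin N → ℝ) :
    gradMat (fun _ : Fin N → ℝ => (0 : Fin d → ℝ)) y = 0 := by
  ext i j; simp [gradMat]

lemma GrowthC.qc_le {N d : ℕ} {C : ℝ} {h : (Fin d → Fin N → ℝ) → ℝ} (H : GrowthC C h)
    {φ : (Fin N → ℝ) → (Fin d → ℝ)} (hφ : TestFun φ) (ξ : Fin d → Fin N → ℝ) :
    qcEnv h ξ ≤ ∫ y in unitCube N, h (ξ + gradMat φ y) := by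
  refine csInf_le ⟨-C, ?_⟩ ⟨φ, hφ, rfl⟩
  rintro r ⟨ψ, hψ, rfl⟩
  exact H.neg_le_integral hψ ξ

lemma le_qc {N d : ℕ} {h : (Fin d → Fin N → ℝ) → ℝ} (ξ : Fin d → Fin N → ℝ) {a : ℝ}
    (ha : ∀ φ : (Fin N → ℝ) → (Fin d → ℝ), TestFun φ →
      a ≤ ∫ y in unitCube N, h (ξ + gradMat φ y)) : a ≤ qcEnv h ξ := by
  refine le_csInf ⟨_, _, testFun_zero, rfl⟩ ?_
  rintro r ⟨ψ, hψ, rfl⟩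
  exact ha ψ hψ

lemma le_mul_qc {N d : ℕ} {h : (Fin d → Fin N → ℝ) → ℝ} (ξ : Fin d → Fin N → ℝ) {a c : ℝ}
    (hc : 0 < c) (ha : ∀ φ : (Fin N → ℝ) → (Fin d → ℝ), TestFun φ →
      a ≤ c * ∫ y in unitCube N, h (ξ + gradMat φ y)) : a ≤ c * qcEnv h ξ := by
  have : a / c ≤ qcEnv h ξ := le_qc ξ fun φ hφ => (div_le_iff₀' hc).2 (ha φ hφ)
  exact (div_le_iff₀' hc).1 this

lemma GrowthC.neg_le_qc {N d : ℕ} {C : ℝ} {h : (Fin d → Fin N → ℝ) → ℝ} (H : GrowthC C h)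
    (ξ : Fin d → Fin N → ℝ) : -C ≤ qcEnv h ξ :=
  le_qc ξ fun _ hφ => H.neg_le_integral hφ ξ

lemma GrowthC.qc_upper {N d : ℕ} {C : ℝ} {h : (Fin d → Fin N → ℝ) → ℝ} (H : GrowthC C h)
    (ξ : Fin d → Fin N → ℝ) : qcEnv h ξ ≤ C * (1 + ‖ξ‖) := by
  refine (H.qc_le testFun_zero ξ).trans ?_
  simpa [gradMat_zero] using H.upper ξ

/-- Dependence of the envelope on the integrand. -/
lemma qc_compare {N d : ℕ} {C w : ℝ} (hw : 0 ≤ w) {h k : (Fin d → Fin N → ℝ) → ℝ}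
    (H : GrowthC C h) (K : GrowthC C k) (hk : ∀ ξ, |k ξ - h ξ| ≤ w * (1 + ‖ξ‖))
    (ξ : Fin d → Fin N → ℝ) :
    qcEnv k ξ ≤ qcEnv h ξ + w * (1 + C * C + C * (C * (1 + ‖ξ‖))) := by
  have hC := H.pos
  have key : qcEnv k ξ - w * (1 + C * C) ≤ (1 + w * C) * qcEnv h ξ := by
    refine le_mul_qc ξ (by positivity) fun φ hφ => ?_
    have h1 := K.qc_le hφ ξ
    have hi : Integrable (fun y => (1 + w * C) * h (ξ + gradMat φ y) + w * (1 + C * C))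
        (volume.restrict (unitCube N)) :=
      ((H.integrable hφ ξ).const_mul _).add (integrable_const _)
    have h2 := integral_mono (K.integrable hφ ξ) hi (fun y => by
      have a := H.lower (ξ + gradMat φ y)
      have b := (abs_le.1 (hk (ξ + gradMat φ y))).2
      have c : ‖ξ + gradMat φ y‖ ≤ C * (h (ξ + gradMat φ y) + C) := by
        have := mul_le_mul_of_nonneg_left a hC.le
        have e : C * (1 / C * ‖ξ + gradMat φ y‖ - C) = ‖ξ + gradMat φ y‖ - C * C := by
          field_simp
        rw [e] at this
        linarith
      have := mul_le_mul_of_nonneg_left c hw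
      show k (ξ + gradMat φ y) ≤ (1 + w * C) * h (ξ + gradMat φ y) + w * (1 + C * C)
      linarith)
    rw [integral_add ((H.integrable hφ ξ).const_mul _) (integrable_const _),
      integral_const_mul] at h2
    simp at h2
    linarith
  have := mul_le_mul_of_nonneg_left (H.qc_upper ξ) (mul_nonneg hw hC.le)
  linarith

/-- The linear map of a matrix. -/
def matMap {N d : ℕ} (ζ : Fin d → Fin N → ℝ) : (Fin N → ℝ) →L[ℝ] (Fin d → ℝ) :=
  LinearMap.toContinuousLinearMap (Matrix.toLin' (Matrix.of ζ))

lemma matMap_apply {N d : ℕ} (ζ : Fin d → Fin N → ℝ) (y : Fin N → ℝ) (i : Fin d) :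
    matMap ζ y i = ∑ j, ζ i j * y j := by
  simp [matMap, Matrix.mulVec, dotProduct]

lemma matMap_norm {N d : ℕ} (ζ : Fin d → Fin N → ℝ) (y : Fin N → ℝ) :
    ‖matMap ζ y‖ ≤ N * ‖ζ‖ * ‖y‖ := by
  refine (pi_norm_le_iff_of_nonneg (by positivity)).2 fun i => ?_
  rw [matMap_apply]
  refine (norm_sum_le _ _).trans ?_
  calc _ ≤ ∑ j : Fin N, ‖ζ‖ * ‖y‖ := Finset.sum_le_sum fun j _ => by
        rw [norm_mul]
        exact mul_le_mul ((norm_le_pi_norm (ζ i) j).trans (norm_le_pi_norm ζ i))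
          (norm_le_pi_norm y j) (norm_nonneg _) (norm_nonneg _)
    _ = _ := by simp [mul_assoc]

/-- Inner cube membership through the rescaling map. -/
lemma scale_mem {N : ℕ} {δ : ℝ} (hδ' : δ < 1 / 2) (y : Fin N → ℝ) :
    (1 - 2 * δ)⁻¹ • (y - fun _ => δ) ∈ unitCube N ↔ ∀ i, y i ∈ Ioo δ (1 - δ) := by
  have hs : 0 < 1 - 2 * δ := by linarith
  simp only [unitCube, mem_univ_pi, mem_Ioo, Pi.smul_apply, Pi.sub_apply, smul_eq_mul]
  refine forall_congr' fun i => ?_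
  rw [inv_mul_lt_iff₀ hs, inv_mul_eq_div, div_pos_iff_of_pos_right hs]
  constructor <;> rintro ⟨a, b⟩ <;> constructor <;> linarith

/-- The transition layer. -/
lemma exists_layer {N d : ℕ} (ζ : Fin d → Fin N → ℝ) {δ : ℝ} (hδ : 0 < δ) (hδ' : δ < 1 / 2)
    (hζ : ‖ζ‖ = δ) :
    ∃ g : (Fin N → ℝ) → (Fin d → ℝ), LipschitzWith (N : NNReal) g ∧
      (∀ y ∉ unitCube N, g y = 0) ∧ (∀ y, (∀ i, y i ∈ Ioo δ (1 - δ)) → g y = matMap ζ y) := by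
  classical
  set P : Set (Fin N → ℝ) := {y | ∀ i, y i ∈ Ioo δ (1 - δ)} with hP
  have hPQ : ∀ y ∈ P, y ∈ unitCube N := fun y hy i _ =>
    ⟨hδ.trans (hy i).1, (hy i).2.trans (by linarith)⟩
  have cross : ∀ y ∈ P, ∀ z ∉ unitCube N, ‖matMap ζ y‖ ≤ N * ‖y - z‖ := by
    intro y hy z hz
    have h1 : δ ≤ ‖y - z‖ := by
      simp only [unitCube, mem_univ_pi, not_forall] at hz
      obtain ⟨i, hi⟩ := hz
      refine le_trans ?_ (norm_le_pi_norm (y - z) i)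
      rw [Real.norm_eq_abs, Pi.sub_apply]
      obtain ⟨h2, h3⟩ := hy i
      by_cases h0 : 0 < z i
      · have : 1 ≤ z i := by
          by_contra hcon
          exact hi ⟨h0, not_le.1 hcon⟩
        rw [abs_sub_comm]
        exact le_trans (by linarith) (le_abs_self _)
      · exact le_trans (by linarith) (le_abs_self _)
    have h2 : ‖y‖ ≤ 1 := (pi_norm_le_iff_of_nonneg zero_le_one).2 fun i => by
      have := hPQ y hy i (mem_univ _)
      rw [Real.norm_eq_abs, abs_le]
      constructor <;> linarith [this.1, this.2]
    calc ‖matMap ζ y‖ ≤ N * ‖ζ‖ * ‖y‖ := matMap_norm ζ y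
      _ ≤ N * ‖ζ‖ * 1 := by gcongr
      _ = N * δ := by rw [hζ, mul_one]
      _ ≤ _ := by gcongr
  have hL : LipschitzOnWith (N : NNReal) (fun y => if y ∈ P then matMap ζ y else 0)
      (P ∪ (unitCube N)ᶜ) := by
    refine LipschitzOnWith.of_dist_le_mul fun y hy z hz => ?_
    rw [dist_eq_norm, dist_eq_norm]
    by_cases hyP : y ∈ P <;> by_cases hzP : z ∈ P
    · simp only [hyP, hzP, if_true]
      rw [← map_sub]
      refine (matMap_norm ζ _).trans ?_
      rw [hζ]
      have : (N : ℝ) * δ ≤ N * 1 := by gcongr; linarith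
      simpa using mul_le_mul_of_nonneg_right this (norm_nonneg (y - z))
    · have hz' := hz.resolve_left hzP
      simp only [hyP, hzP, if_true, if_false, sub_zero]
      simpa using cross y hyP z hz'
    · have hy' := hy.resolve_left hyP
      simp only [hyP, hzP, if_true, if_false, zero_sub, norm_neg]
      rw [norm_sub_rev]
      simpa using cross z hzP y hy'
    · simp only [hyP, hzP, if_false, sub_zero, norm_zero]
      positivity
  obtain ⟨g, hg, hgE⟩ := hL.extend_pi
  refine ⟨g, hg, fun y hy => ?_, fun y hy => ?_⟩
  · rw [← hgE (Or.inr hy)]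
    exact if_neg fun h => hy (hPQ y h)
  · rw [← hgE (Or.inl hy)]
    exact if_pos hy

/-- The key estimate in the matrix variable. -/
lemma qc_xi {N d : ℕ} {C : ℝ} {h : (Fin d → Fin N → ℝ) → ℝ} (H : GrowthC C h)
    (ξ ξ' : Fin d → Fin N → ℝ) (h0 : 0 < ‖ξ' - ξ‖) (h1 : ‖ξ' - ξ‖ < 1 / 2) :
    qcEnv h ξ - (1 - (1 - 2 * ‖ξ' - ξ‖) ^ N) * (C * (1 + (‖ξ‖ + N)))
      ≤ (1 - 2 * ‖ξ' - ξ‖) ^ N * qcEnv h ξ' := by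
  have hC := H.pos
  set δ := ‖ξ' - ξ‖ with hδ
  set s := 1 - 2 * δ with hs
  set M := C * (1 + (‖ξ‖ + N)) with hM
  have hs0 : 0 < s := by rw [hs]; linarith
  obtain ⟨g, hgL, hg0, hg1⟩ := exists_layer (ξ' - ξ) h0 h1 rfl
  refine le_mul_qc ξ' (pow_pos hs0 N) fun φ hφ => ?_
  obtain ⟨⟨K, hK⟩, hφ0⟩ := id hφ
  set c : Fin N → ℝ := fun _ => δ with hc
  set T : (Fin N → ℝ) → (Fin N → ℝ) := fun y => s⁻¹ • (y - c) with hT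
  have hTQ : ∀ y, T y ∈ unitCube N ↔ ∀ i, y i ∈ Ioo δ (1 - δ) := fun y => scale_mem h1 y
  have hTQ' : ∀ y, T y ∈ unitCube N → y ∈ unitCube N := fun y hy i _ =>
    ⟨h0.trans ((hTQ y).1 hy i).1, ((hTQ y).1 hy i).2.trans (by linarith)⟩
  set φt : (Fin N → ℝ) → (Fin d → ℝ) := fun y => s • φ (T y) with hφt
  have hTL : LipschitzWith (Real.toNNReal s⁻¹) T := by
    refine LipschitzWith.of_dist_le_mul fun y z => ?_
    rw [hT, dist_smul₀, dist_sub_right, Real.coe_toNNReal _ (by positivity), Real.norm_eq_abs,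
      abs_of_pos (by positivity)]
  have hφtL : LipschitzWith (‖s‖₊ * (K * Real.toNNReal s⁻¹)) φt :=
    (lipschitzWith_smul s).comp (hK.comp hTL)
  have hφtg : ∀ y, fderiv ℝ φt y = fderiv ℝ φ (T y) := by
    intro y
    have e1 : φt = s • fun y => φ (T y) := rfl
    rw [e1, fderiv_const_smul_field, Pi.smul_apply]
    have e2 : fderiv ℝ (fun y => φ (T y)) y = s⁻¹ • fderiv ℝ φ (T y) := by
      have := fderiv_comp_sub (𝕜 := ℝ) (f := fun z => φ (s⁻¹ • z)) (x := y) c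
      rw [show (fun y => φ (T y)) = fun y => (fun z => φ (s⁻¹ • z)) (y - c) from rfl, this,
        fderiv_comp_smul]
    rw [e2, smul_smul, mul_inv_cancel₀ hs0.ne', one_smul]
  have hψ : TestFun (g + φt) := by
    refine ⟨⟨_, hgL.add hφtL⟩, fun y hy => ?_⟩
    have : φ (T y) = 0 := hφ0 _ fun h => hy (hTQ' y h)
    simp [hg0 y hy, hφt, this]
  set G : (Fin N → ℝ) → ℝ :=
    (unitCube N).indicator fun y => h (ξ' + gradMat φ y) - M with hG
  have hmeas := (isOpen_unitCube N).measurableSet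
  have hfi : IntegrableOn (fun y => h (ξ' + gradMat φ y) - M) (unitCube N) :=
    (H.integrable hφ ξ').sub (integrable_const _)
  have hGi : Integrable G := (integrable_indicator_iff hmeas).2 hfi
  have hGTi : Integrable (fun y => G (T y)) := by
    have := (hGi.comp_smul (inv_ne_zero hs0.ne')).comp_sub_right c
    exact this
  have hGT : ∫ y, G (T y) = s ^ N * ∫ y, G y := by
    have e1 := integral_sub_right_eq_self (μ := volume) (fun z => G (s⁻¹ • z)) c
    have e2 := Measure.integral_comp_smul (volume : Measure (Fin N → ℝ)) G s⁻¹
    rw [show (fun y => G (T y)) = fun y => (fun z => G (s⁻¹ • z)) (y - c) from rfl, e1, e2]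
    simp [abs_of_pos (pow_pos hs0 N), smul_eq_mul]
  have hGint : ∫ y, G y = (∫ y in unitCube N, h (ξ' + gradMat φ y)) - M := by
    rw [hG, integral_indicator hmeas, integral_sub (H.integrable hφ ξ') (integrable_const _)]
    simp
  have hGTs : ∫ y in unitCube N, G (T y) = ∫ y, G (T y) :=
    setIntegral_eq_integral_of_forall_compl_eq_zero fun y hy =>
      indicator_of_notMem (fun h => hy (hTQ' y h)) _
  have hbdry : ∀ᵐ y : Fin N → ℝ, y ∈ Icc c (fun _ => 1 - δ) → ∀ i, y i ∈ Ioo δ (1 - δ) := by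
    have := (Measure.univ_pi_Ioo_ae_eq_Icc (μ := fun _ : Fin N => (volume : Measure ℝ))
      (f := c) (g := fun _ => 1 - δ))
    filter_upwards [this.mem_iff] with y hy hy' i
    exact (hy.2 hy') i (mem_univ _)
  have hpt : ∀ᵐ y : Fin N → ℝ, h (ξ + gradMat (g + φt) y) ≤ M + G (T y) := by
    filter_upwards [hbdry, hφtL.ae_differentiableAt, hgL.ae_differentiableAt] with y hy hd hd'
    by_cases hin : T y ∈ unitCube N
    · rw [hG, indicator_of_mem hin]
      have hev : g =ᶠ[nhds y] matMap (ξ' - ξ) := by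
        have ho : IsOpen {y : Fin N → ℝ | ∀ i, y i ∈ Ioo δ (1 - δ)} := by
          simp only [setOf_forall]
          exact isOpen_iInter_of_finite fun i => isOpen_Ioo.preimage (continuous_apply i)
        filter_upwards [ho.mem_nhds ((hTQ y).1 hin)] with z hz using hg1 z hz
      have : ξ + gradMat (g + φt) y = ξ' + gradMat φ (T y) := by
        ext i j
        simp only [Pi.add_apply, gradMat]
        rw [fderiv_add hd' hd, hφtg, hev.fderiv_eq, ContinuousLinearMap.fderiv]
        simp [matMap_apply, Pi.single_apply]
        ring
      rw [this]
      linarith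
    · rw [hG, indicator_of_notMem hin]
      have hnot : y ∉ Icc c (fun _ => 1 - δ) := fun hh => hin ((hTQ y).2 (hy hh))
      have hev : g + φt =ᶠ[nhds y] g := by
        filter_upwards [isClosed_Icc.isOpen_compl.mem_nhds hnot] with z hz
        have : T z ∉ unitCube N := fun hh => hz
          ⟨fun i => ((hTQ z).1 hh i).1.le, fun i => ((hTQ z).1 hh i).2.le⟩
        simp [hφt, hφ0 _ this]
      have e : gradMat (g + φt) y = gradMat g y := by
        ext i j
        simp only [gradMat, hev.fderiv_eq]
      rw [e, add_zero]
      refine (H.upper _).trans ?_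
      rw [hM]
      have := norm_gradMat_le hgL y
      simp only [NNReal.coe_natCast] at this
      gcongr
      exact (norm_add_le _ _).trans (by gcongr)
  have h3 := H.qc_le hψ ξ
  have h4 : ∫ y in unitCube N, h (ξ + gradMat (g + φt) y) ≤ ∫ y in unitCube N, (M + G (T y)) :=
    integral_mono_ae (H.integrable hψ ξ) ((integrable_const _).add hGTi.integrableOn)
      (ae_restrict_of_ae hpt)
  rw [integral_add (integrable_const _) hGTi.integrableOn, hGTs, hGT, hGint] at h4
  simp at h4
  linarith

lemma qc_xi_abs {N d : ℕ} {C : ℝ} {h : (Fin d → Fin N → ℝ) → ℝ} (H : GrowthC C h)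
    (ξ ξ' : Fin d → Fin N → ℝ) (h1 : ‖ξ' - ξ‖ < 1 / 2) :
    |qcEnv h ξ' - qcEnv h ξ| ≤
      (1 - (1 - 2 * ‖ξ' - ξ‖) ^ N) * (C * (1 + (‖ξ‖ + 1 + N)) + C) := by
  have hC := H.pos
  rcases (norm_nonneg (ξ' - ξ)).eq_or_lt with h0 | h0
  · have : ξ' = ξ := sub_eq_zero.1 (norm_eq_zero.1 h0.symm)
    simp [this]
  have a := qc_xi H ξ ξ' h0 h1
  have b := qc_xi H ξ' ξ (by rwa [norm_sub_rev]) (by rwa [norm_sub_rev])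
  rw [norm_sub_rev ξ ξ'] at b
  have hp : 0 ≤ 1 - (1 - 2 * ‖ξ' - ξ‖) ^ N :=
    sub_nonneg.2 (pow_le_one₀ (by linarith) (by linarith))
  set p := 1 - (1 - 2 * ‖ξ' - ξ‖) ^ N with hpd
  have hp' : (1 - 2 * ‖ξ' - ξ‖) ^ N = 1 - p := by rw [hpd]; ring
  rw [hp'] at a b
  have n1 : ‖ξ'‖ ≤ ‖ξ‖ + 1 := by
    have := norm_add_le ξ (ξ' - ξ)
    rw [add_sub_cancel] at this
    linarith
  have m1 : C * (1 + (‖ξ‖ + N)) ≤ C * (1 + (‖ξ‖ + 1 + N)) := by gcongr; linarith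
  have m2 : C * (1 + (‖ξ'‖ + N)) ≤ C * (1 + (‖ξ‖ + 1 + N)) := by gcongr
  have a1 := mul_le_mul_of_nonneg_left m1 hp
  have b1 := mul_le_mul_of_nonneg_left m2 hp
  have a2 := mul_le_mul_of_nonneg_left (H.neg_le_qc ξ) hp
  have b2 := mul_le_mul_of_nonneg_left (H.neg_le_qc ξ') hp
  rw [abs_le]
  constructor <;> linarith

theorem stmt3 {N d : ℕ} (Ω : Set (Fin N → ℝ)) (hΩo : IsOpen Ω) (hΩb : Bornology.IsBounded Ω)
    (W : (Fin N → ℝ) → (Fin d → ℝ) → (Fin d → Fin N → ℝ) → ℝ)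
    (hWcont : Continuous fun p : (Fin N → ℝ) × (Fin d → ℝ) × (Fin d → Fin N → ℝ) =>
      W p.1 p.2.1 p.2.2)
    (C : ℝ) (hC : 0 < C)
    (hW : ∀ x ∈ Ω, ∀ (u : Fin d → ℝ) (ξ : Fin d → Fin N → ℝ),
      (1 / C) * ‖ξ‖ - C ≤ W x u ξ ∧ W x u ξ ≤ C * (1 + ‖ξ‖))
    (hmod : ∀ K : Set ((Fin N → ℝ) × (Fin d → ℝ)), IsCompact K → K ⊆ Ω ×ˢ Set.univ →
      ∃ ω : ℝ → ℝ, Modulus ω ∧ ∀ p ∈ K, ∀ q ∈ K, ∀ ξ : Fin d → Fin N → ℝ,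
        |W p.1 p.2 ξ - W q.1 q.2 ξ| ≤ ω (‖p.1 - q.1‖ + ‖p.2 - q.2‖) * (1 + ‖ξ‖)) :
    ContinuousOn
      (fun p : (Fin N → ℝ) × (Fin d → ℝ) × (Fin d → Fin N → ℝ) =>
        qcEnv (W p.1 p.2.1) p.2.2)
      (Ω ×ˢ (Set.univ : Set ((Fin d → ℝ) × (Fin d → Fin N → ℝ)))) := by
  rintro ⟨x₀, u₀, ξ₀⟩ ⟨hx₀, -⟩
  have hG : ∀ x ∈ Ω, ∀ u, GrowthC C (W x u) := fun x hx u =>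
    ⟨hWcont.comp (continuous_const.prodMk (continuous_const.prodMk continuous_id)), hC,
      fun ξ => (hW x hx u ξ).1, fun ξ => (hW x hx u ξ).2⟩
  obtain ⟨r, hr, hrΩ⟩ := Metric.nhds_basis_closedBall.mem_iff.1 (hΩo.mem_nhds hx₀)
  obtain ⟨ω, ⟨hωc, hω0, hωn⟩, hω⟩ := hmod (Metric.closedBall x₀ r ×ˢ Metric.closedBall u₀ 1)
    ((isCompact_closedBall _ _).prod (isCompact_closedBall _ _))
    (prod_mono hrΩ (subset_univ _))
  set A := C * (1 + (‖ξ₀‖ + 1 + N)) + C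
  set B := 1 + C * C + C * (C * (1 + ‖ξ₀‖))
  refine ContinuousAt.continuousWithinAt ?_
  set bd : (Fin N → ℝ) × (Fin d → ℝ) × (Fin d → Fin N → ℝ) → ℝ := fun p =>
    (1 - (1 - 2 * ‖p.2.2 - ξ₀‖) ^ N) * A + ω (‖p.1 - x₀‖ + ‖p.2.1 - u₀‖) * B with hbd
  have hbc : Continuous bd := by rw [hbd]; fun_prop
  have hb0 : bd (x₀, u₀, ξ₀) = 0 := by simp [hbd, hω0]
  have hlim : Tendsto bd (nhds (x₀, u₀, ξ₀)) (nhds 0) := by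
    have := hbc.tendsto (x₀, u₀, ξ₀)
    rwa [hb0] at this
  refine tendsto_iff_dist_tendsto_zero.2 (squeeze_zero' (Eventually.of_forall fun _ => dist_nonneg)
    ?_ hlim)
  have n1 : ∀ᶠ p in nhds (x₀, u₀, ξ₀), p.1 ∈ Metric.closedBall x₀ r :=
    continuous_fst.continuousAt.eventually_mem (Metric.closedBall_mem_nhds _ hr)
  have n2 : ∀ᶠ p in nhds (x₀, u₀, ξ₀), p.2.1 ∈ Metric.closedBall u₀ 1 :=
    (continuous_fst.comp continuous_snd).continuousAt.eventually_mem
      (Metric.closedBall_mem_nhds _ one_pos)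
  have n3 : ∀ᶠ p in nhds (x₀, u₀, ξ₀), p.2.2 ∈ Metric.ball ξ₀ (1 / 2) :=
    (continuous_snd.comp continuous_snd).continuousAt.eventually_mem
      (Metric.ball_mem_nhds _ (by norm_num))
  filter_upwards [n1, n2, n3] with p h1 h2 h3
  have H0 := hG x₀ hx₀ u₀
  have H1 := hG p.1 (hrΩ h1) p.2.1
  have hw : ∀ ξ, |W p.1 p.2.1 ξ - W x₀ u₀ ξ| ≤ ω (‖p.1 - x₀‖ + ‖p.2.1 - u₀‖) * (1 + ‖ξ‖) :=
    hω (p.1, p.2.1) ⟨h1, h2⟩ (x₀, u₀)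
      ⟨Metric.mem_closedBall_self hr.le, Metric.mem_closedBall_self zero_le_one⟩
  have c1 := qc_compare (hωn _) H0 H1 hw ξ₀
  have c2 := qc_compare (hωn _) H1 H0 (fun ξ => by rw [abs_sub_comm]; exact hw ξ) ξ₀
  have c3 := abs_le.1 (qc_xi_abs H1 ξ₀ p.2.2 (by rwa [← dist_eq_norm]))
  rw [Real.dist_eq, abs_le]
  constructor <;> simp only [hbd] <;> linarith [c3.1, c3.2]

end
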